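/- arXiv:2105.05698 — 7 statements merged into one kernel-verified Lean document; each statement's English description precedes it below -/
import Mathlib

section
/- Let n ≥ 1 and consider n+1 qubits labeled 0,1,…,n. Let H = Σ_{j=1}^{n} (I − X₀X_j − Y₀Y_j − Z₀Z_j) ∈ ℂ^{2^{n+1}×2^{n+1}}. Then the largest eigenvalue of H equals 2(n+1). -/
open Matrix

/-- The 2×2 Pauli X matrix. -/
noncomputable def pauliX : Matrix (Fin 2) (Fin 2) ℂ := !![0, 1; 1, 0]

/-- The 2×2 Pauli Y matrix. -/
noncomputable def pauliY : Matrix (Fin 2) (Fin 2) ℂ := !![0, -Complex.I; Complex.I, 0]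

/-- The 2×2 Pauli Z matrix. -/
noncomputable def pauliZ : Matrix (Fin 2) (Fin 2) ℂ := !![1, 0; 0, -1]

/-- The operator `σ_i σ_j` on `m` qubits: the Kronecker product with the 2×2 matrix `σ`
at positions `i` and `j` and the 2×2 identity elsewhere.  We identify `ℂ^{2^m}` with
functions `Fin m → Fin 2`, so that the Kronecker product has entries given by the
product of the entries of the factors. -/
noncomputable def twoLocal {m : ℕ} (σ : Matrix (Fin 2) (Fin 2) ℂ) (i j : Fin m) :
    Matrix (Fin m → Fin 2) (Fin m → Fin 2) ℂ :=
  Matrix.of fun f g => ∏ k, (if k = i ∨ k = j then σ else 1) (f k) (g k)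

theorem comp_swap_eq_self {ι α : Type*} [DecidableEq ι] {f : ι → α} {i j : ι} (h : f i = f j) :
    f ∘ Equiv.swap i j = f := by
  funext k
  simp only [Function.comp_apply, Equiv.swap_apply_def]
  split_ifs with h₁ h₂
  · rw [h₁, h]
  · rw [h₂, h]
  · rfl

/-- The antisymmetrizer on three tensor factors of `ℂ²` vanishes. -/
theorem antisymmetrizer_three_qubits {ι R : Type*} [DecidableEq ι] [CommRing R]
    (v : (ι → Fin 2) → R) (f : ι → Fin 2) {i j k : ι} (hij : i ≠ j) (hik : i ≠ k) (hjk : j ≠ k) :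
    v (f ∘ Equiv.swap i j ∘ Equiv.swap i k) + v (f ∘ Equiv.swap i k ∘ Equiv.swap i j) =
      v (f ∘ Equiv.swap i j) + v (f ∘ Equiv.swap i k) + v (f ∘ Equiv.swap j k) - v f := by
  have hpair : f i = f j ∨ f i = f k ∨ f j = f k := by omega
  have e₁ : ⇑(Equiv.swap i j) ∘ ⇑(Equiv.swap i k) = Equiv.swap i k ∘ Equiv.swap j k := by
    funext x; simp only [Function.comp_apply, Equiv.swap_apply_def]; grind
  have e₂ : ⇑(Equiv.swap i k) ∘ ⇑(Equiv.swap i j) = Equiv.swap i j ∘ Equiv.swap j k := by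
    funext x; simp only [Function.comp_apply, Equiv.swap_apply_def]; grind
  have e₃ : ⇑(Equiv.swap i j) ∘ ⇑(Equiv.swap i k) = Equiv.swap j k ∘ Equiv.swap i j := by
    funext x; simp only [Function.comp_apply, Equiv.swap_apply_def]; grind
  have e₄ : ⇑(Equiv.swap i k) ∘ ⇑(Equiv.swap i j) = Equiv.swap j k ∘ Equiv.swap i k := by
    funext x; simp only [Function.comp_apply, Equiv.swap_apply_def]; grind
  rcases hpair with h | h | h
  · rw [e₂, ← Function.comp_assoc, ← Function.comp_assoc, comp_swap_eq_self h]; ring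
  · rw [e₁, ← Function.comp_assoc, ← Function.comp_assoc, comp_swap_eq_self h]; ring
  · rw [e₃, e₄, ← Function.comp_assoc, ← Function.comp_assoc, comp_swap_eq_self h]; ring

theorem re_sum_conj_mul_comp_le {α : Type*} [Fintype α] (v : α → ℂ) (e : α ≃ α) :
    (∑ a, star (v a) * v (e a)).re ≤ ∑ a, ‖v a‖ ^ 2 := by
  have h : ∑ a, ‖v (e a)‖ ^ 2 = ∑ a, ‖v a‖ ^ 2 := e.sum_comp fun a => ‖v a‖ ^ 2
  have h' : ∑ a, (star (v a) * v (e a)).re ≤ ∑ a, (‖v a‖ ^ 2 + ‖v (e a)‖ ^ 2) / 2 := by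
    refine Finset.sum_le_sum fun a _ => ?_
    have := Complex.re_le_norm (star (v a) * v (e a))
    rw [norm_mul, norm_star] at this
    nlinarith [sq_nonneg (‖v a‖ - ‖v (e a)‖)]
  rw [Complex.re_sum]
  rw [← Finset.sum_div, Finset.sum_add_distrib, h] at h'
  linarith

/-- The sum of the transpositions joining a fixed qubit to the elements of `S` has spectrum
bounded below by `-1`. -/
theorem neg_one_le_of_sum_comp_swap {ι : Type*} [Fintype ι] [DecidableEq ι] (i : ι) (S : Finset ι)
    (hi : i ∉ S) (v : (ι → Fin 2) → ℂ) (hv : v ≠ 0) (μ : ℝ)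
    (h : ∀ f, ∑ j ∈ S, v (f ∘ Equiv.swap i j) = μ * v f) : -1 ≤ μ := by
  have key (f : ι → Fin 2) : 2 * ((μ : ℂ) - S.card) * (μ + 1) * v f =
      ∑ j ∈ S, ∑ k ∈ S, (v (f ∘ Equiv.swap j k) - v f) := by
    have hsq : ∑ j ∈ S, ∑ k ∈ S, v (f ∘ Equiv.swap i j ∘ Equiv.swap i k) = μ * (μ * v f) := by
      simp_rw [← Function.comp_assoc, h, ← Finset.mul_sum, h]
    have hsq' : ∑ j ∈ S, ∑ k ∈ S, v (f ∘ Equiv.swap i k ∘ Equiv.swap i j) = μ * (μ * v f) := by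
      rw [Finset.sum_comm, hsq]
    have hsum : ∑ j ∈ S, ∑ k ∈ S, (v (f ∘ Equiv.swap i j ∘ Equiv.swap i k) +
        v (f ∘ Equiv.swap i k ∘ Equiv.swap i j)) =
        ∑ j ∈ S, ∑ k ∈ S, (v (f ∘ Equiv.swap i j) + v (f ∘ Equiv.swap i k) +
          (v (f ∘ Equiv.swap j k) - v f) +
          if j = k then 2 * v f - 2 * v (f ∘ Equiv.swap i j) else 0) := by
      refine Finset.sum_congr rfl fun j hj => Finset.sum_congr rfl fun k hk => ?_
      split_ifs with hjk
      · subst hjk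
        have : ⇑(Equiv.swap i j) ∘ ⇑(Equiv.swap i j) = id := by funext x; simp
        rw [this]
        simp
        ring
      · rw [antisymmetrizer_three_qubits v f (by grind) (by grind) hjk]
        ring
    simp only [Finset.sum_add_distrib, hsq, hsq', Finset.sum_const, Finset.sum_ite_eq, h,
      nsmul_eq_mul, ← Finset.mul_sum] at hsum
    rw [Finset.sum_congr rfl (fun j hj => if_pos hj)] at hsum
    simp only [Finset.sum_sub_distrib, Finset.sum_const, h, nsmul_eq_mul, ← Finset.mul_sum]
      at hsum ⊢
    linear_combination hsum
  have hpos : 0 < ∑ f, ‖v f‖ ^ 2 := by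
    obtain ⟨f, hf⟩ := Function.ne_iff.mp hv
    exact Finset.sum_pos' (fun _ _ => by positivity)
      ⟨f, Finset.mem_univ f, by have := norm_pos_iff.mpr hf; positivity⟩
  have hself (f : ι → Fin 2) : star (v f) * v f = ((‖v f‖ ^ 2 : ℝ) : ℂ) := by
    rw [Complex.star_def, Complex.conj_mul']; norm_cast
  have hquad : 2 * (μ - S.card) * (μ + 1) * ∑ f, ‖v f‖ ^ 2 ≤ 0 := by
    have e : ((2 * (μ - S.card) * (μ + 1) * ∑ f, ‖v f‖ ^ 2 : ℝ) : ℂ) =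
        ∑ j ∈ S, ∑ k ∈ S, (∑ f, star (v f) * v (f ∘ Equiv.swap j k) -
          ((∑ f, ‖v f‖ ^ 2 : ℝ) : ℂ)) := by
      have : ∑ f, star (v f) * (2 * ((μ : ℂ) - S.card) * (μ + 1) * v f) =
          ∑ f, star (v f) * ∑ j ∈ S, ∑ k ∈ S, (v (f ∘ Equiv.swap j k) - v f) := by
        simp_rw [key]
      simp_rw [Finset.mul_sum, mul_sub] at this
      rw [Finset.sum_comm] at this
      simp_rw [Finset.sum_comm (s := Finset.univ) (t := S),
        Finset.sum_sub_distrib (s := Finset.univ), hself] at this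
      push_cast at this ⊢
      rw [← this, Finset.mul_sum]
      refine Finset.sum_congr rfl fun f _ => ?_
      have := hself f
      push_cast at this
      linear_combination -(2 * ((μ : ℂ) - S.card) * (μ + 1)) * this
    have e' := congrArg Complex.re e
    rw [Complex.ofReal_re] at e'
    rw [e']
    simp only [Complex.re_sum, Complex.sub_re, Complex.ofReal_re]
    refine Finset.sum_nonpos fun j _ => Finset.sum_nonpos fun k _ => ?_
    have := re_sum_conj_mul_comp_le v ((Equiv.swap j k).arrowCongr (Equiv.refl (Fin 2)))
    rw [Complex.re_sum] at this
    simpa [Equiv.arrowCongr] using this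
  by_contra! hμ
  have : 0 < (μ - S.card) * (μ + 1) :=
    mul_pos_of_neg_of_neg (by linarith [(Nat.cast_nonneg S.card : (0 : ℝ) ≤ S.card)]) (by linarith)
  nlinarith [mul_pos this hpos]

theorem pauli_exchange_entry (a b c d : Fin 2) :
    (1 : Matrix (Fin 2) (Fin 2) ℂ) a c * (1 : Matrix (Fin 2) (Fin 2) ℂ) b d
      - pauliX a c * pauliX b d - pauliY a c * pauliY b d - pauliZ a c * pauliZ b d =
    2 * ((if a = c ∧ b = d then 1 else 0) - if b = c ∧ a = d then 1 else 0) := by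
  fin_cases a <;> fin_cases b <;> fin_cases c <;> fin_cases d <;>
    norm_num [pauliX, pauliY, pauliZ]

theorem twoLocal_apply {m : ℕ} (σ : Matrix (Fin 2) (Fin 2) ℂ) {i j : Fin m} (hij : i ≠ j)
    (f g : Fin m → Fin 2) :
    twoLocal σ i j f g = σ (f i) (g i) * σ (f j) (g j) *
      if ∀ k, k ≠ i → k ≠ j → f k = g k then 1 else 0 := by
  have hj : j ∈ Finset.univ.erase i := by simp [hij.symm]
  rw [twoLocal, Matrix.of_apply, ← Finset.mul_prod_erase _ _ (Finset.mem_univ i),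
    ← Finset.mul_prod_erase _ _ hj, ← mul_assoc]
  simp only [true_or, or_true, if_true]
  congr 1
  have : ∀ k ∈ (Finset.univ.erase i).erase j,
      (if k = i ∨ k = j then σ else 1) (f k) (g k) = if f k = g k then (1 : ℂ) else 0 := by
    intro k hk
    simp only [Finset.mem_erase, Finset.mem_univ, and_true] at hk
    simp [hk.1, hk.2, Matrix.one_apply]
  rw [Finset.prod_congr rfl this, Finset.prod_boole]
  have hiff : (∀ k ∈ (Finset.univ.erase i).erase j, f k = g k) ↔
      ∀ k, k ≠ i → k ≠ j → f k = g k := by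
    simp only [Finset.mem_erase, Finset.mem_univ, and_true]
    grind
  by_cases h : ∀ k, k ≠ i → k ≠ j → f k = g k
  · rw [if_pos h, if_pos (hiff.mpr h)]
  · rw [if_neg h, if_neg (mt hiff.mp h)]

theorem exchange_apply {m : ℕ} {i j : Fin m} (hij : i ≠ j) (f g : Fin m → Fin 2) :
    ((1 : Matrix (Fin m → Fin 2) (Fin m → Fin 2) ℂ)
      - twoLocal pauliX i j - twoLocal pauliY i j - twoLocal pauliZ i j) f g =
    2 * ((if f = g then 1 else 0) - if f ∘ Equiv.swap i j = g then 1 else 0) := by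
  have h₁ : f = g ↔ (∀ k, k ≠ i → k ≠ j → f k = g k) ∧ f i = g i ∧ f j = g j := by
    rw [funext_iff]; grind
  have h₂ : f ∘ Equiv.swap i j = g ↔
      (∀ k, k ≠ i → k ≠ j → f k = g k) ∧ f j = g i ∧ f i = g j := by
    simp only [funext_iff, Function.comp_apply, Equiv.swap_apply_def]; grind
  have h := pauli_exchange_entry (f i) (f j) (g i) (g j)
  simp only [Matrix.sub_apply, twoLocal_apply _ hij, Matrix.one_apply, h₁, h₂] at h ⊢
  by_cases hk : ∀ k, k ≠ i → k ≠ j → f k = g k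
  · simp only [eq_true hk, true_and, if_true, mul_one]
    rw [← h]
    congr 3
    split_ifs <;> simp_all
  · simp [hk]

theorem exchange_mulVec {m : ℕ} {i j : Fin m} (hij : i ≠ j) (v : (Fin m → Fin 2) → ℂ)
    (f : Fin m → Fin 2) :
    (((1 : Matrix (Fin m → Fin 2) (Fin m → Fin 2) ℂ)
      - twoLocal pauliX i j - twoLocal pauliY i j - twoLocal pauliZ i j) *ᵥ v) f =
    2 * (v f - v (f ∘ Equiv.swap i j)) := by
  simp only [Matrix.mulVec, dotProduct, exchange_apply hij, mul_assoc, sub_mul, ite_mul, one_mul,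
    zero_mul, ← Finset.mul_sum, Finset.sum_sub_distrib, Finset.sum_ite_eq, Finset.mem_univ, if_true]

theorem exists_sum_comp_swap_eq_neg {n : ℕ} (hn : 1 ≤ n) : ∃ v : (Fin (n + 1) → Fin 2) → ℂ, v ≠ 0 ∧
    ∀ f, ∑ j ∈ Finset.univ.erase 0, v (f ∘ Equiv.swap 0 j) = -v f := by
  let c : Fin (n + 1) → ℂ := fun k => if k = 0 then -n else 1
  let e : Fin (n + 1) → Fin (n + 1) → Fin 2 := fun k => Pi.single k 1
  have he (k l : Fin (n + 1)) : e k = e l ↔ k = l := by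
    refine ⟨fun h => ?_, fun h => h ▸ rfl⟩
    by_contra hkl
    have := congrFun h k
    simp [e, hkl] at this
  have hswap (f : Fin (n + 1) → Fin 2) (j k : Fin (n + 1)) :
      f ∘ Equiv.swap 0 j = e (Equiv.swap 0 j k) ↔ f = e k := by
    have : e (Equiv.swap 0 j k) = e k ∘ Equiv.swap 0 j := by
      funext x
      simp only [e, Pi.single_apply, Function.comp_apply, Equiv.swap_apply_eq_iff]
    rw [this]
    exact (Equiv.swap 0 j).surjective.injective_comp_right.eq_iff
  have hc (k : Fin (n + 1)) : ∑ j ∈ Finset.univ.erase 0, c (Equiv.swap 0 j k) = -c k := by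
    by_cases hk : k = 0
    · subst hk
      rw [Finset.sum_congr rfl (g := fun _ => (1 : ℂ)) (by intro j hj; simp at hj; simp [c, hj])]
      simp [c]
    · have hk' : k ∈ Finset.univ.erase 0 := by simp [hk]
      rw [← Finset.add_sum_erase _ _ hk', Finset.sum_congr rfl (g := fun _ => (1 : ℂ)) (by
        intro j hj
        simp only [Finset.mem_erase, Finset.mem_univ, and_true] at hj
        rw [Equiv.swap_apply_of_ne_of_ne hk (Ne.symm hj.1)]
        simp [c, hk])]
      simp [c, hk, Finset.card_erase_of_mem hk', Nat.cast_sub hn]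
      ring
  refine ⟨fun f => ∑ k, if f = e k then c k else 0, fun h => ?_, fun f => ?_⟩
  · have hlast : Fin.last n ≠ 0 := by simp [Fin.ext_iff]; omega
    have := congrFun h (e (Fin.last n))
    simp [he, c, hlast] at this
  · have (j : Fin (n + 1)) : (∑ k, if f ∘ Equiv.swap 0 j = e k then c k else 0) =
        ∑ k, if f = e k then c (Equiv.swap 0 j k) else 0 := by
      rw [← Equiv.sum_comp (Equiv.swap 0 j)]
      simp only [hswap]
    simp only [this]
    rw [Finset.sum_comm, ← Finset.sum_neg_distrib]
    refine Finset.sum_congr rfl fun k _ => ?_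
    split_ifs
    · exact hc k
    · simp


/-- Star bound: for `n ≥ 1` and `n+1` qubits labeled `0,1,…,n`, the largest eigenvalue of
`H = Σ_{j=1}^{n} (I − X₀X_j − Y₀Y_j − Z₀Z_j)` equals `2(n+1)`. -/
theorem star_bound (n : ℕ) (hn : 1 ≤ n)
    (H : Matrix (Fin (n + 1) → Fin 2) (Fin (n + 1) → Fin 2) ℂ)
    (hH : H = ∑ j ∈ Finset.univ.erase (0 : Fin (n + 1)),
      ((1 : Matrix (Fin (n + 1) → Fin 2) (Fin (n + 1) → Fin 2) ℂ)
        - twoLocal pauliX 0 j - twoLocal pauliY 0 j - twoLocal pauliZ 0 j))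
    (hHerm : H.IsHermitian) :
    (⨆ v, hHerm.eigenvalues v) = 2 * ((n : ℝ) + 1) := by
  have hmul (v : (Fin (n + 1) → Fin 2) → ℂ) (f : Fin (n + 1) → Fin 2) :
      (H *ᵥ v) f = 2 * (n * v f - ∑ j ∈ Finset.univ.erase 0, v (f ∘ Equiv.swap 0 j)) := by
    rw [hH, Matrix.sum_mulVec, Finset.sum_apply, Finset.sum_congr rfl fun j hj =>
      exchange_mulVec (Finset.ne_of_mem_erase hj).symm v f]
    simp [← Finset.mul_sum]
  have hle (i) : hHerm.eigenvalues i ≤ 2 * ((n : ℝ) + 1) := by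
    have hne : (hHerm.eigenvectorBasis i : (Fin (n + 1) → Fin 2) → ℂ) ≠ 0 := fun h =>
      hHerm.eigenvectorBasis.toBasis.ne_zero i (by ext f; simpa using congrFun h f)
    have := neg_one_le_of_sum_comp_swap 0 (Finset.univ.erase 0) (by simp) _ hne
      (n - hHerm.eigenvalues i / 2) fun f => by
        have h := congrFun (hHerm.mulVec_eigenvectorBasis i) f
        rw [hmul, Pi.smul_apply, Complex.real_smul] at h
        push_cast
        linear_combination -h / 2
    linarith
  obtain ⟨w, hw, hw'⟩ := exists_sum_comp_swap_eq_neg hn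
  have hmem : 2 * ((n : ℝ) + 1) ∈ Set.range hHerm.eigenvalues := by
    rw [← hHerm.spectrum_real_eq_range_eigenvalues]
    refine spectrum.of_algebraMap_mem ℂ ?_
    rw [← Matrix.spectrum_toLin']
    refine Module.End.HasEigenvalue.mem_spectrum
      (Module.End.hasEigenvalue_of_hasEigenvector (x := w) ⟨?_, hw⟩)
    rw [Module.End.mem_eigenspace_iff, Matrix.toLin'_apply]
    funext f
    rw [hmul, hw', Pi.smul_apply, smul_eq_mul]
    simp
    ring
  obtain ⟨i, hi⟩ := hmem
  exact le_antisymm (ciSup_le hle) (hi ▸ le_ciSup (Set.finite_range _).bddAbove i)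
end

section
/- Let G be the star graph with n leaves (vertex set {0,1,…,n}, edges {0j} for j=1,…,n), with unit weights. Then the supremum over all Lasserre₁-feasible matrices M of the Lasserre₁ objective Σ_{j=1}^n (1 − M(X₀,X_j) − M(Y₀,Y_j) − M(Z₀,Z_j)) equals 4n, and it is attained by a feasible M. -/
open Matrix

/-- Row/column index set for the level-1 Lasserre moment matrix on `n` vertices:
the indices `σ_i` for `σ ∈ {X,Y,Z}` (encoded as `Fin 3`) and `i` a vertex,
together with the identity index `I` (encoded as `Unit`). -/
abbrev L1Idx (n : ℕ) := (Fin 3 × Fin n) ⊕ Unit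

/-- A real symmetric matrix `M`, with rows and columns indexed by
`{σ_i : σ ∈ {X,Y,Z}, i a vertex} ∪ {I}`, is Lasserre₁-feasible if it is positive
semidefinite, has all diagonal entries equal to `1`, and satisfies
`M(σ_i, η_i) = 0` for all distinct `σ, η ∈ {X,Y,Z}` and every vertex `i`. -/
def Lasserre1Feasible {n : ℕ} (M : Matrix (L1Idx n) (L1Idx n) ℝ) : Prop :=
  M.IsSymm ∧ M.PosSemidef ∧ (∀ a, M a a = 1) ∧
    (∀ (i : Fin n) (σ η : Fin 3), σ ≠ η → M (.inl (σ, i)) (.inl (η, i)) = 0)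

/-- An off-diagonal entry of a real positive semidefinite matrix with unit diagonal is at
least `-1`. -/
theorem Matrix.PosSemidef.neg_one_le_apply {ι : Type*} [Fintype ι] [DecidableEq ι]
    {M : Matrix ι ι ℝ} (hM : M.PosSemidef) (hdiag : ∀ a, M a a = 1) (a b : ι) :
    -1 ≤ M a b := by
  have hsymm : M b a = M a b := by simpa using hM.isHermitian.apply a b
  have hquad := hM.dotProduct_mulVec_nonneg (Pi.single a 1 + Pi.single b 1)
  simp [Matrix.mulVec_add, add_dotProduct, hdiag, hsymm] at hquad
  linarith

/-- The Gram matrix of the signed coordinate vectors `s a • e (f a)`. -/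
def signedGram {ι κ : Type*} [DecidableEq κ] (f : ι → κ) (s : ι → ℝ) : Matrix ι ι ℝ :=
  Matrix.of fun a b => if f a = f b then s a * s b else 0

theorem signedGram_posSemidef {ι κ : Type*} [Fintype ι] [Fintype κ] [DecidableEq κ]
    (f : ι → κ) (s : ι → ℝ) : (signedGram f s).PosSemidef := by
  have h : signedGram f s =
      (Matrix.of fun k a => if k = f a then s a else 0)ᴴ *
        (Matrix.of fun k a => if k = f a then s a else 0) := by
    ext a b
    simp [signedGram, Matrix.mul_apply, eq_comm]
  rw [h]
  exact Matrix.posSemidef_conjTranspose_mul_self _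

/-- The signs giving vertex `0` the opposite orientation to every other vertex. -/
def starSign (n : ℕ) : L1Idx (n + 1) → ℝ :=
  Sum.elim (fun p => if p.2 = 0 then 1 else -1) (fun _ => 1)

theorem starSign_mul_self (n : ℕ) (a : L1Idx (n + 1)) : starSign n a * starSign n a = 1 := by
  rcases a with ⟨σ, i⟩ | _
  · by_cases hi : i = 0 <;> simp [starSign, hi]
  · simp [starSign]

/-- The Gram matrix of the orthonormal vectors `e_σ` at vertex `0`, `-e_σ` at every other
vertex, and a further unit vector for the identity index is feasible. -/
theorem lasserre1Feasible_signedGram_starSign (n : ℕ) :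
    Lasserre1Feasible (signedGram (Sum.map Prod.fst id) (starSign n)) := by
  have hpsd := signedGram_posSemidef (Sum.map Prod.fst id) (starSign n)
  refine ⟨?_, hpsd, fun a => ?_, fun i σ η h => ?_⟩
  · simpa [Matrix.IsHermitian, Matrix.IsSymm] using hpsd.isHermitian
  · simp [signedGram, starSign_mul_self]
  · simp [signedGram, h]

/-- For the star graph with `n` leaves (vertex set `{0,1,…,n}`, edges `{0j}` for
`j = 1,…,n`) with unit weights, the supremum over Lasserre₁-feasible matrices `M` of the
Lasserre₁ objective `Σ_{j=1}^n (1 − M(X₀,X_j) − M(Y₀,Y_j) − M(Z₀,Z_j))` equals `4n`,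
and it is attained by a feasible `M`. -/
theorem lasserre1_star (n : ℕ) :
    IsGreatest {r : ℝ | ∃ M : Matrix (L1Idx (n + 1)) (L1Idx (n + 1)) ℝ,
      Lasserre1Feasible M ∧
      r = ∑ j ∈ Finset.univ.erase (0 : Fin (n + 1)),
        (1 - M (.inl (0, 0)) (.inl (0, j)) - M (.inl (1, 0)) (.inl (1, j))
          - M (.inl (2, 0)) (.inl (2, j)))}
      (4 * (n : ℝ)) := by
  constructor
  · refine ⟨_, lasserre1Feasible_signedGram_starSign n, ?_⟩
    rw [Finset.sum_congr rfl (g := fun _ => (4 : ℝ))]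
    · simp [mul_comm]
    · intro j hj
      have hj0 : j ≠ 0 := Finset.ne_of_mem_erase hj
      norm_num [signedGram, starSign, hj0]
  · rintro r ⟨M, ⟨-, hpsd, hdiag, -⟩, rfl⟩
    refine (Finset.sum_le_card_nsmul _ _ 4 fun j _ => ?_).trans ?_
    · linarith [hpsd.neg_one_le_apply hdiag (.inl (0, 0)) (.inl (0, j)),
        hpsd.neg_one_le_apply hdiag (.inl (1, 0)) (.inl (1, j)),
        hpsd.neg_one_le_apply hdiag (.inl (2, 0)) (.inl (2, j))]
    · simp [mul_comm]
end

section
/- Let n ≥ 1, α, β ∈ ℝ, and let Q be the (n+1)×(n+1) real symmetric matrix with all diagonal entries equal to 1, Q(0,i) = Q(i,0) = α for all i ∈ {1,…,n}, and Q(i,j) = β for all distinct i,j ∈ {1,…,n}. If Q is positive semidefinite, then n(1 + (n−1)β) − α²n² ≥ 0. If in addition β ≤ 1/3, then α ≥ −√((1 + (n−1)/3)/n). -/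
open Matrix

theorem dotProduct_mulVec_vecCons_const {n : ℕ} {α β : ℝ}
    {Q : Matrix (Fin (n + 1)) (Fin (n + 1)) ℝ}
    (hdiag : ∀ i, Q i i = 1)
    (hα : ∀ i, i ≠ 0 → Q 0 i = α ∧ Q i 0 = α)
    (hβ : ∀ i j, i ≠ 0 → j ≠ 0 → i ≠ j → Q i j = β) (t : ℝ) :
    (vecCons t fun _ : Fin n ↦ 1) ⬝ᵥ (Q *ᵥ vecCons t fun _ : Fin n ↦ 1) =
      t ^ 2 + 2 * n * α * t + n * (1 + ((n : ℝ) - 1) * β) := by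
  have hrow (i : Fin n) : Q 0 i.succ = α := (hα _ i.succ_ne_zero).1
  have hcol (i : Fin n) : Q i.succ 0 = α := (hα _ i.succ_ne_zero).2
  have hblock (i j : Fin n) : Q i.succ j.succ = β + if i = j then 1 - β else 0 := by
    split_ifs with h
    · simp [h, hdiag]
    · simp [hβ _ _ i.succ_ne_zero j.succ_ne_zero fun h' ↦ h (Fin.succ_injective _ h')]
  simp only [dotProduct, mulVec, Fin.sum_univ_succ, cons_val_zero, cons_val_succ, hdiag, hrow,
    hcol, hblock, mul_one, one_mul, Finset.sum_add_distrib, Finset.sum_const, Finset.card_univ,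
    Fintype.card_fin, nsmul_eq_mul, Finset.sum_ite_eq, Finset.mem_univ, if_true]
  ring

/-- The Schur-complement/all-ones-vector step in the Lasserre₁.₅ star-graph analysis:
if `Q` is the `(n+1)×(n+1)` real symmetric matrix with unit diagonal, first row and
column equal to `α` off the diagonal, and all other off-diagonal entries equal to `β`,
and `Q` is positive semidefinite, then `n(1 + (n−1)β) − α²n² ≥ 0`; if moreover
`β ≤ 1/3`, then `α ≥ −√((1 + (n−1)/3)/n)`. -/
theorem lasserre15_schur (n : ℕ) (hn : 1 ≤ n) (α β : ℝ)
    (Q : Matrix (Fin (n + 1)) (Fin (n + 1)) ℝ)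
    (hsym : Q.IsSymm)
    (hdiag : ∀ i, Q i i = 1)
    (hα : ∀ i, i ≠ 0 → Q 0 i = α ∧ Q i 0 = α)
    (hβ : ∀ i j, i ≠ 0 → j ≠ 0 → i ≠ j → Q i j = β)
    (hQ : Q.PosSemidef) :
    (n : ℝ) * (1 + ((n : ℝ) - 1) * β) - α ^ 2 * (n : ℝ) ^ 2 ≥ 0 ∧
      (β ≤ 1 / 3 → α ≥ -Real.sqrt ((1 + ((n : ℝ) - 1) / 3) / n)) := by
  have hschur : (n : ℝ) * (1 + ((n : ℝ) - 1) * β) - α ^ 2 * (n : ℝ) ^ 2 ≥ 0 := by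
    have h := hQ.dotProduct_mulVec_nonneg (vecCons (-(n * α)) fun _ : Fin n ↦ 1)
    rw [star_trivial, dotProduct_mulVec_vecCons_const hdiag hα hβ] at h
    linarith
  refine ⟨hschur, fun hβ3 ↦ neg_le_of_abs_le (Real.abs_le_sqrt ?_)⟩
  have hn1 : (1 : ℝ) ≤ n := by exact_mod_cast hn
  have hn0 : (0 : ℝ) < n := by linarith
  rw [le_div_iff₀ hn0]
  have hα2 : α ^ 2 * n ≤ 1 + ((n : ℝ) - 1) * β :=
    le_of_mul_le_mul_left (by linarith) hn0
  linarith [mul_le_mul_of_nonneg_left hβ3 (sub_nonneg.2 hn1)]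
end

section
/- Let M be a Lasserre₂-feasible matrix on n' qubits, let 0 be a qubit and j₁,…,j_n be n distinct qubits different from 0. Then Σ_{k=1}^{n} (1 − M(X₀X_{j_k}, I) − M(Y₀Y_{j_k}, I) − M(Z₀Z_{j_k}, I)) ≤ 2(n+1); equivalently, Σ_{k=1}^{n} (1 + 3·x_{0 j_k}) ≤ 2(n+1). -/
open Matrix

/-- The 2×2 Pauli matrices `I, X, Y, Z`, indexed by `Fin 4` (with `0 ↦ I`). -/
noncomputable def pauli : Fin 4 → Matrix (Fin 2) (Fin 2) ℂ
  | 0 => 1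
  | 1 => !![0, 1; 1, 0]
  | 2 => !![0, -Complex.I; Complex.I, 0]
  | 3 => !![1, 0; 0, -1]

/-- A Pauli word on `n` qubits: a choice of `I, X, Y` or `Z` for each qubit. -/
abbrev PauliWord (n : ℕ) := Fin n → Fin 4

/-- The matrix of a Pauli word: the `n`-fold Kronecker product of its letters, realized
on `ℂ^{2^n}` identified with functions `Fin n → Fin 2`, so the entries are products of
entries of the 2×2 factors. -/
noncomputable def wordMat {n : ℕ} (w : PauliWord n) :
    Matrix (Fin n → Fin 2) (Fin n → Fin 2) ℂ :=
  Matrix.of fun f g => ∏ k, pauli (w k) (f k) (g k)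

/-- The weight of a Pauli word: the number of non-identity letters. -/
def wordWeight {n : ℕ} (w : PauliWord n) : ℕ :=
  (Finset.univ.filter fun k => w k ≠ 0).card

/-- `P_n(2)`: Pauli words on `n` qubits with at most 2 non-identity factors. -/
abbrev PauliWord2 (n : ℕ) := {w : PauliWord n // wordWeight w ≤ 2}

/-- The all-identity Pauli word, as an element of `P_n(2)`. -/
def idWord (n : ℕ) : PauliWord2 n := ⟨fun _ => 0, by simp [wordWeight]⟩

/-- The Pauli word `σ_i σ_j` with letter `σ` at positions `i` and `j` and identity
elsewhere, as an element of `P_n(2)`. -/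
def pairWord {n : ℕ} (σ : Fin 4) (i j : Fin n) : PauliWord2 n :=
  ⟨fun k => if k = i ∨ k = j then σ else 0, by
    classical
    unfold wordWeight
    have hsub : (Finset.univ.filter fun k =>
        (if k = i ∨ k = j then σ else (0 : Fin 4)) ≠ 0) ⊆ ({i, j} : Finset (Fin n)) := by
      intro k hk
      simp only [Finset.mem_filter, Finset.mem_univ, true_and] at hk
      simp only [Finset.mem_insert, Finset.mem_singleton]
      by_contra h
      push_neg at h
      exact hk (if_neg (by tauto))
    exact le_trans (Finset.card_le_card hsub)
      (by simpa using Finset.card_insert_le i ({j} : Finset (Fin n)))⟩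

/-- A real symmetric matrix `M` with rows and columns indexed by `P_n(2)` is
Lasserre₂-feasible if it is positive semidefinite, has unit diagonal, vanishes at pairs
whose Pauli product is not Hermitian, and respects equality (resp. negation) of Pauli
products. -/
def Lasserre2Feasible {n : ℕ} (M : Matrix (PauliWord2 n) (PauliWord2 n) ℝ) : Prop :=
  M.IsSymm ∧ M.PosSemidef ∧
  (∀ Γ, M Γ Γ = 1) ∧
  (∀ Γ Φ : PauliWord2 n, ¬(wordMat Γ.1 * wordMat Φ.1).IsHermitian → M Γ Φ = 0) ∧
  (∀ Γ Φ Γ' Φ' : PauliWord2 n,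
    wordMat Γ.1 * wordMat Φ.1 = wordMat Γ'.1 * wordMat Φ'.1 → M Γ Φ = M Γ' Φ') ∧
  (∀ Γ Φ Γ' Φ' : PauliWord2 n,
    wordMat Γ.1 * wordMat Φ.1 = -(wordMat Γ'.1 * wordMat Φ'.1) → M Γ Φ = -M Γ' Φ')

/-- The edge value `v_ij` from a Lasserre₂ moment matrix. -/
noncomputable def edgeVal {n : ℕ} (M : Matrix (PauliWord2 n) (PauliWord2 n) ℝ)
    (i j : Fin n) : ℝ :=
  (M (pairWord 1 i j) (idWord n) + M (pairWord 2 i j) (idWord n)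
    + M (pairWord 3 i j) (idWord n)) / 3

/-- The Kronecker product of a family of 2×2 matrices. -/
noncomputable def kronMat {n : ℕ} (A : Fin n → Matrix (Fin 2) (Fin 2) ℂ) :
    Matrix (Fin n → Fin 2) (Fin n → Fin 2) ℂ :=
  Matrix.of fun f g => ∏ k, A k (f k) (g k)

theorem wordMat_mul {n : ℕ} (w v : PauliWord n) :
    wordMat w * wordMat v = kronMat fun k => pauli (w k) * pauli (v k) := by
  ext f g
  simp only [wordMat, kronMat, Matrix.mul_apply, Matrix.of_apply, ← Finset.prod_mul_distrib]
  rw [Finset.prod_univ_sum]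
  simp [Fintype.piFinset_univ]

theorem kronMat_smul {n : ℕ} (s : Fin n → ℂ) (A : Fin n → Matrix (Fin 2) (Fin 2) ℂ) :
    (kronMat fun k => s k • A k) = (∏ k, s k) • kronMat A := by
  ext f g
  simp [kronMat, Finset.prod_mul_distrib]

theorem pauli_mul_self (a : Fin 4) : pauli a * pauli a = 1 := by
  fin_cases a <;> ext i j <;> fin_cases i <;> fin_cases j <;> simp [pauli]

theorem pauli_anticomm {a b : Fin 4} (ha : a ≠ 0) (hb : b ≠ 0) (hab : a ≠ b) :
    pauli a * pauli b = (-1 : ℂ) • (pauli b * pauli a) := by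
  fin_cases a <;> fin_cases b <;> first | contradiction | skip
  all_goals
    ext i j
    fin_cases i <;> fin_cases j <;> simp [pauli]

theorem pauli_one_mul_two : pauli 1 * pauli 2 = Complex.I • pauli 3 := by
  ext i j; fin_cases i <;> fin_cases j <;> simp [pauli]

theorem pauli_two_mul_three : pauli 2 * pauli 3 = Complex.I • pauli 1 := by
  ext i j; fin_cases i <;> fin_cases j <;> simp [pauli]

theorem pauli_one_mul_three : pauli 1 * pauli 3 = (-Complex.I) • pauli 2 := by
  ext i j; fin_cases i <;> fin_cases j <;> simp [pauli]

theorem pairWord_mul_same {n : ℕ} {a b c : Fin 4} {s : ℂ} (hs : s * s = -1)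
    (h : pauli a * pauli b = s • pauli c) {i j : Fin n} (hij : i ≠ j) :
    wordMat (pairWord a i j).1 * wordMat (pairWord b i j).1 =
      -(wordMat (pairWord c i j).1 * wordMat (idWord n).1) := by
  have hprod : ∏ k : Fin n, (if k = i ∨ k = j then s else 1) = -1 := by
    rw [← hs, ← Finset.prod_pair hij (f := fun _ => s), Finset.prod_ite]
    simp only [Finset.prod_const_one, mul_one]
    congr 1
    ext k
    simp
  rw [wordMat_mul, wordMat_mul, ← neg_one_smul ℂ, ← hprod, ← kronMat_smul]
  congr 1
  funext k
  have h1 : pauli 0 = 1 := rfl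
  by_cases hk : k = i ∨ k = j
  · simp [pairWord, idWord, hk, h, h1]
  · simp [pairWord, idWord, hk, h1]

theorem pairWord_mul_shared {n : ℕ} (a : Fin 4) {z k l : Fin n} (hk : k ≠ z) (hl : l ≠ z)
    (hkl : k ≠ l) :
    wordMat (pairWord a z k).1 * wordMat (pairWord a z l).1 =
      wordMat (pairWord a k l).1 * wordMat (idWord n).1 := by
  rw [wordMat_mul, wordMat_mul]
  congr 1
  funext m
  have h1 : pauli 0 = 1 := rfl
  by_cases hmz : m = z
  · subst hmz
    simp [pairWord, idWord, hk.symm, hl.symm, h1, pauli_mul_self]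
  by_cases hmk : m = k
  · subst hmk
    simp [pairWord, idWord, hk, hkl, h1]
  by_cases hml : m = l
  · subst hml
    simp [pairWord, idWord, hl, hmk, h1]
  · simp [pairWord, idWord, hmz, hmk, hml]

theorem pairWord_anticomm_shared {n : ℕ} {a b : Fin 4} (ha : a ≠ 0) (hb : b ≠ 0) (hab : a ≠ b)
    {z k l : Fin n} (hk : k ≠ z) (hl : l ≠ z) (hkl : k ≠ l) :
    wordMat (pairWord a z k).1 * wordMat (pairWord b z l).1 =
      -(wordMat (pairWord b z l).1 * wordMat (pairWord a z k).1) := by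
  have hprod : ∏ m : Fin n, (if m = z then (-1 : ℂ) else 1) = -1 := by simp
  rw [wordMat_mul, wordMat_mul, ← neg_one_smul ℂ, ← hprod, ← kronMat_smul]
  congr 1
  funext m
  have h1 : pauli 0 = 1 := rfl
  by_cases hmz : m = z
  · subst hmz
    simpa [pairWord] using pauli_anticomm ha hb hab
  by_cases hmk : m = k
  · subst hmk
    simp [pairWord, hk, hkl, h1]
  · simp [pairWord, hmz, hmk, h1]

theorem Matrix.PosSemidef.exists_gram_vectors {ι : Type*} [Finite ι] {M : Matrix ι ι ℝ}
    (hM : M.PosSemidef) :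
    ∃ (m : ℕ) (V : ι → EuclideanSpace ℝ (Fin m)), ∀ a b, inner ℝ (V a) (V b) = M a b := by
  obtain ⟨m, v, rfl⟩ := Matrix.posSemidef_iff_eq_sum_vecMulVec.mp hM
  refine ⟨m, fun a => WithLp.toLp 2 fun i => v i a, fun a b => ?_⟩
  simp [PiLp.inner_apply, Matrix.sum_apply, Matrix.vecMulVec_apply, mul_comm]

/-- The Gram vector of `X_iX_j + Y_iY_j + Z_iZ_j`. -/
def heisenbergVec {n : ℕ} {E : Type*} [AddCommGroup E] (V : PauliWord2 n → E) (i j : Fin n) : E :=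
  V (pairWord 1 i j) + V (pairWord 2 i j) + V (pairWord 3 i j)

section Gram

variable {n : ℕ} {M : Matrix (PauliWord2 n) (PauliWord2 n) ℝ} {E : Type*}
  [NormedAddCommGroup E] [InnerProductSpace ℝ E] {V : PauliWord2 n → E}

theorem inner_heisenbergVec_self (hM : Lasserre2Feasible M)
    (hV : ∀ Γ Φ, inner ℝ (V Γ) (V Φ) = M Γ Φ) {i j : Fin n} (hij : i ≠ j) :
    inner ℝ (heisenbergVec V i j) (heisenbergVec V i j) =
      3 - 2 * inner ℝ (heisenbergVec V i j) (V (idWord n)) := by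
  obtain ⟨hsymm, -, hdiag, -, -, hneg⟩ := hM
  have hI : Complex.I * Complex.I = -1 := Complex.I_mul_I
  have hI' : -Complex.I * -Complex.I = -1 := by simp
  have h12 := hneg _ _ _ _ (pairWord_mul_same hI pauli_one_mul_two hij)
  have h23 := hneg _ _ _ _ (pairWord_mul_same hI pauli_two_mul_three hij)
  have h13 := hneg _ _ _ _ (pairWord_mul_same hI' pauli_one_mul_three hij)
  simp only [heisenbergVec, inner_add_left, inner_add_right, hV, hdiag]
  rw [hsymm.apply (pairWord 1 i j) (pairWord 2 i j), hsymm.apply (pairWord 1 i j) (pairWord 3 i j),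
    hsymm.apply (pairWord 2 i j) (pairWord 3 i j), h12, h23, h13]
  ring

theorem inner_heisenbergVec_idWord_le_one (hM : Lasserre2Feasible M)
    (hV : ∀ Γ Φ, inner ℝ (V Γ) (V Φ) = M Γ Φ) {i j : Fin n} (hij : i ≠ j) :
    inner ℝ (heisenbergVec V i j) (V (idWord n)) ≤ 1 := by
  have hself := inner_heisenbergVec_self hM hV hij
  have hCS := real_inner_mul_inner_self_le (heisenbergVec V i j) (V (idWord n))
  rw [hself, hV (idWord n) (idWord n), hM.2.2.1] at hCS
  nlinarith

theorem inner_heisenbergVec_shared (hM : Lasserre2Feasible M)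
    (hV : ∀ Γ Φ, inner ℝ (V Γ) (V Φ) = M Γ Φ) {z k l : Fin n} (hk : k ≠ z) (hl : l ≠ z)
    (hkl : k ≠ l) :
    inner ℝ (heisenbergVec V z k) (heisenbergVec V z l) =
      inner ℝ (heisenbergVec V k l) (V (idWord n)) := by
  obtain ⟨hsymm, -, -, -, heq, hneg⟩ := hM
  have hsame (a : Fin 4) := heq _ _ _ _ (pairWord_mul_shared a hk hl hkl)
  have hzero {a b : Fin 4} (ha : a ≠ 0) (hb : b ≠ 0) (hab : a ≠ b) :
      M (pairWord a z k) (pairWord b z l) = 0 := by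
    have h := hneg _ _ _ _ (pairWord_anticomm_shared ha hb hab hk hl hkl)
    rw [hsymm.apply (pairWord a z k) (pairWord b z l)] at h
    linarith
  simp only [heisenbergVec, inner_add_left, inner_add_right, hV, hsame]
  rw [hzero (a := 1) (b := 2) (by decide) (by decide) (by decide),
    hzero (a := 1) (b := 3) (by decide) (by decide) (by decide),
    hzero (a := 2) (b := 1) (by decide) (by decide) (by decide),
    hzero (a := 2) (b := 3) (by decide) (by decide) (by decide),
    hzero (a := 3) (b := 1) (by decide) (by decide) (by decide),
    hzero (a := 3) (b := 2) (by decide) (by decide) (by decide)]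
  ring

end Gram

/-- Star bound for Lasserre₂: if `M` is a Lasserre₂-feasible matrix on `n'` qubits, `z` is
a qubit and `j 1, …, j n` are `n` distinct qubits different from `z`, then
`Σ_{k=1}^{n} (1 − M(X_zX_{j k}, I) − M(Y_zY_{j k}, I) − M(Z_zZ_{j k}, I)) ≤ 2(n+1)`. -/
theorem lasserre2_star_bound {n' : ℕ} (M : Matrix (PauliWord2 n') (PauliWord2 n') ℝ)
    (hM : Lasserre2Feasible M) (n : ℕ) (z : Fin n') (j : Fin n → Fin n')
    (hinj : Function.Injective j) (hz : ∀ k, j k ≠ z) :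
    ∑ k : Fin n,
      (1 - M (pairWord 1 z (j k)) (idWord n') - M (pairWord 2 z (j k)) (idWord n')
        - M (pairWord 3 z (j k)) (idWord n')) ≤ 2 * ((n : ℝ) + 1) := by
  obtain ⟨m, V, hV⟩ := hM.2.1.exists_gram_vectors
  set e := V (idWord n') with he
  let T := ∑ k, heisenbergVec V z (j k)
  have hee : inner ℝ e e = 1 := by rw [he, hV, hM.2.2.1]
  have hentry (k l : Fin n) : inner ℝ (heisenbergVec V z (j k)) (heisenbergVec V z (j l)) ≤
      1 + if k = l then 2 - 2 * inner ℝ (heisenbergVec V z (j k)) e else 0 := by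
    split_ifs with hkl
    · subst hkl
      rw [inner_heisenbergVec_self hM hV (hz k).symm]
      linarith
    · rw [inner_heisenbergVec_shared hM hV (hz k) (hz l) (hinj.ne hkl), add_zero]
      exact inner_heisenbergVec_idWord_le_one hM hV (hinj.ne hkl)
  have hTe : inner ℝ T e = ∑ k, inner ℝ (heisenbergVec V z (j k)) e := sum_inner _ _ _
  have hTT : inner ℝ T T ≤ (n : ℝ) ^ 2 + 2 * n - 2 * inner ℝ T e := by
    calc inner ℝ T T = ∑ k, ∑ l, inner ℝ (heisenbergVec V z (j k)) (heisenbergVec V z (j l)) := by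
          simp only [T, sum_inner]
          exact Finset.sum_congr rfl fun k _ => inner_sum _ _ _
      _ ≤ ∑ k : Fin n, ∑ l : Fin n,
          (1 + if k = l then 2 - 2 * inner ℝ (heisenbergVec V z (j k)) e else 0) :=
        Finset.sum_le_sum fun k _ => Finset.sum_le_sum fun l _ => hentry k l
      _ = _ := by
        simp [hTe, Finset.sum_add_distrib, Finset.mul_sum]
        ring
  have hCS := real_inner_mul_inner_self_le (T + e) e
  simp only [inner_add_left, inner_add_right, hee, real_inner_comm T e] at hCS
  have hlower : -((n : ℝ) + 2) ≤ inner ℝ T e := by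
    have hsq : (inner ℝ T e + 1) ^ 2 ≤ ((n : ℝ) + 1) ^ 2 := by nlinarith
    have := abs_le_of_sq_le_sq' hsq (by positivity)
    linarith
  have hsum : ∑ k, (1 - M (pairWord 1 z (j k)) (idWord n') - M (pairWord 2 z (j k)) (idWord n')
        - M (pairWord 3 z (j k)) (idWord n')) = n - inner ℝ T e := by
    rw [hTe]
    simp only [heisenbergVec, he, inner_add_left, hV, Finset.sum_sub_distrib,
      Finset.sum_add_distrib]
    simp
    ring
  rw [hsum]
  linarith
end

section
/- Let M be a Lasserre₂-feasible matrix on n qubits and let i,j be distinct qubits. Then 0 ≤ 1 − M(X_iX_j, I) − M(Y_iY_j, I) − M(Z_iZ_j, I) ≤ 4; equivalently, −1 ≤ v_ij ≤ 1/3. -/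
open Matrix

/-- Pauli words multiply letter by letter. -/
theorem wordMat_mul_apply {n : ℕ} (u v : PauliWord n) (f g : Fin n → Fin 2) :
    (wordMat u * wordMat v) f g = ∏ k, (pauli (u k) * pauli (v k)) (f k) (g k) := by
  simp only [wordMat, Matrix.mul_apply, Matrix.of_apply, ← Finset.prod_mul_distrib]
  rw [Finset.prod_univ_sum, Fintype.piFinset_univ]

/-- If two letters multiply to `ω` times a third one, where `ω ^ 2 = -1`, then the
corresponding pair words multiply to minus the third pair word. -/
theorem wordMat_pairWord_mul {n : ℕ} {i j : Fin n} (hij : i ≠ j) {σ τ ρ : Fin 4} {ω : ℂ}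
    (hω : ω ^ 2 = -1) (h : pauli σ * pauli τ = ω • pauli ρ) :
    wordMat (pairWord σ i j).1 * wordMat (pairWord τ i j).1 =
      -(wordMat (pairWord ρ i j).1 * wordMat (idWord n).1) := by
  ext f g
  rw [Matrix.neg_apply, wordMat_mul_apply, wordMat_mul_apply]
  have hphase : ∏ k, (if k = i ∨ k = j then ω else 1) = -1 := by
    have hfilter : (Finset.univ.filter fun k => k = i ∨ k = j) = {i, j} := by
      ext k
      simp
    rw [Finset.prod_ite, Finset.prod_const, Finset.prod_const_one, hfilter,
      Finset.card_pair hij, hω, mul_one]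
  rw [← neg_one_mul, ← hphase, ← Finset.prod_mul_distrib]
  refine Finset.prod_congr rfl fun k _ => ?_
  by_cases hk : k = i ∨ k = j
  · simp only [pairWord, idWord, if_pos hk, h]
    simp [pauli]
  · simp [pairWord, idWord, hk, pauli]

theorem pauli_three_mul_one : pauli 3 * pauli 1 = Complex.I • pauli 2 := by
  ext a b
  fin_cases a <;> fin_cases b <;> simp [pauli, Matrix.mul_apply]

/-- Lasserre₂ edge bound: for a Lasserre₂-feasible matrix `M` on `n` qubits and distinct
qubits `i, j`, one has `0 ≤ 1 − M(X_iX_j, I) − M(Y_iY_j, I) − M(Z_iZ_j, I) ≤ 4`;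
equivalently, `−1 ≤ v_ij ≤ 1/3`. -/
theorem lasserre2_edge_bound {n : ℕ} (M : Matrix (PauliWord2 n) (PauliWord2 n) ℝ)
    (hM : Lasserre2Feasible M) (i j : Fin n) (hij : i ≠ j) :
    (0 ≤ 1 - M (pairWord 1 i j) (idWord n) - M (pairWord 2 i j) (idWord n)
        - M (pairWord 3 i j) (idWord n) ∧
      1 - M (pairWord 1 i j) (idWord n) - M (pairWord 2 i j) (idWord n)
        - M (pairWord 3 i j) (idWord n) ≤ 4) ∧
    (-1 ≤ edgeVal M i j ∧ edgeVal M i j ≤ 1 / 3) := by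
  obtain ⟨hsymm, hpsd, hdiag, -, -, hneg⟩ := hM
  have h12 := hneg _ _ _ _ (wordMat_pairWord_mul hij Complex.I_sq pauli_one_mul_two)
  have h23 := hneg _ _ _ _ (wordMat_pairWord_mul hij Complex.I_sq pauli_two_mul_three)
  have h31 := hneg _ _ _ _ (wordMat_pairWord_mul hij Complex.I_sq pauli_three_mul_one)
  have h21 := (hsymm.apply (pairWord 1 i j) (pairWord 2 i j)).trans h12
  have h32 := (hsymm.apply (pairWord 2 i j) (pairWord 3 i j)).trans h23
  have h13 := (hsymm.apply (pairWord 3 i j) (pairWord 1 i j)).trans h31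
  have hid (σ : Fin 4) := hsymm.apply (pairWord σ i j) (idWord n)
  have hsub := hpsd.submatrix ![idWord n, pairWord 1 i j, pairWord 2 i j, pairWord 3 i j]
  have hupper := hsub.dotProduct_mulVec_nonneg ![1, -1, -1, -1]
  have hlower := hsub.dotProduct_mulVec_nonneg ![3, 1, 1, 1]
  simp [dotProduct, Matrix.mulVec, Fin.sum_univ_four, hdiag, hid, h12, h23, h31, h21, h32, h13]
    at hupper hlower
  unfold edgeVal
  refine ⟨⟨?_, ?_⟩, ?_, ?_⟩ <;> linarith
end

section
/- Let V be a finite set and v a symmetric real-valued function on unordered pairs of distinct elements of V such that for all distinct i,j,k ∈ V: 1 + v_ij + v_ik + v_jk ≥ 0 and 1 + v_ij − v_ik − v_jk ≥ 0. Then for every cycle of odd length m ≥ 3 on distinct vertices c₀, …, c_{m−1}, one has Σ_{i=0}^{m−1} v_{c_i c_{i+1 mod m}} ≥ 2 − m. -/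
/-- Lower bound on the sum of an even-length path, obtained by summing triangle inequalities
over the fan of triangles with apex the first vertex. -/
theorem even_path_sum_add_chord_ge {V : Type*} (v : V → V → ℝ)
    (hsymm : ∀ i j : V, i ≠ j → v i j = v j i)
    (htri1 : ∀ i j k : V, i ≠ j → i ≠ k → j ≠ k → 1 + v i j + v i k + v j k ≥ 0)
    (htri2 : ∀ i j k : V, i ≠ j → i ≠ k → j ≠ k → 1 + v i j - v i k - v j k ≥ 0)
    (f : ℕ → V) (k : ℕ) (hf : Set.InjOn f (Set.Iic (2 * k + 2))) :
    -(2 * k + 1 : ℝ) ≤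
      ∑ i ∈ Finset.range (2 * k + 2), v (f i) (f (i + 1)) + v (f (2 * k + 2)) (f 0) := by
  have hne : ∀ a b, a ≤ 2 * k + 2 → b ≤ 2 * k + 2 → a ≠ b → f a ≠ f b :=
    fun a b ha hb hab h => hab (hf ha hb h)
  induction k with
  | zero =>
    have h := htri1 (f 0) (f 1) (f 2) (hne _ _ (by simp) (by simp) (by simp))
      (hne _ _ (by simp) (by simp) (by simp)) (hne _ _ (by simp) (by simp) (by simp))
    have hs := hsymm (f 0) (f 2) (hne _ _ (by simp) (by simp) (by simp))
    simp [Finset.sum_range_succ]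
    linarith
  | succ k ih =>
    have hprev := ih (hf.mono (Set.Iic_subset_Iic.2 (by omega)))
      fun a b ha hb => hne a b (by omega) (by omega)
    have h2 := htri2 (f (2 * k + 2)) (f (2 * k + 3)) (f 0)
      (hne _ _ (by omega) (by omega) (by omega)) (hne _ _ (by omega) (by omega) (by omega))
      (hne _ _ (by omega) (by omega) (by omega))
    have h1 := htri1 (f (2 * k + 3)) (f (2 * k + 4)) (f 0)
      (hne _ _ (by omega) (by omega) (by omega)) (hne _ _ (by omega) (by omega) (by omega))
      (hne _ _ (by omega) (by omega) (by omega))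
    rw [show 2 * (k + 1) + 2 = 2 * k + 2 + 1 + 1 by ring, Finset.sum_range_succ,
      Finset.sum_range_succ]
    push_cast
    linarith

/-- Combinatorial odd-cycle inequality: let `v` be a symmetric real-valued function on
pairs of distinct elements of a finite set `V` satisfying, for all distinct `i, j, k`,
the triangle inequalities `1 + v_ij + v_ik + v_jk ≥ 0` and `1 + v_ij − v_ik − v_jk ≥ 0`.
Then for every cycle of odd length `m ≥ 3` on distinct vertices `c 0, …, c (m−1)`,
`Σ_{i=0}^{m−1} v_{c i, c (i+1 mod m)} ≥ 2 − m`. -/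
theorem odd_cycle_from_triangles {V : Type*} [Fintype V] (v : V → V → ℝ)
    (hsymm : ∀ i j : V, i ≠ j → v i j = v j i)
    (htri1 : ∀ i j k : V, i ≠ j → i ≠ k → j ≠ k → 1 + v i j + v i k + v j k ≥ 0)
    (htri2 : ∀ i j k : V, i ≠ j → i ≠ k → j ≠ k → 1 + v i j - v i k - v j k ≥ 0)
    (m : ℕ) [NeZero m] (hm3 : 3 ≤ m) (hmodd : Odd m)
    (c : Fin m → V) (hc : Function.Injective c) :
    ∑ i : Fin m, v (c i) (c (i + 1)) ≥ 2 - (m : ℝ) := by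
  obtain ⟨n, rfl⟩ := hmodd
  obtain ⟨k, rfl⟩ : ∃ k, n = k + 1 := ⟨n - 1, by omega⟩
  have hinj : Set.InjOn (fun i : ℕ => c (Fin.ofNat (2 * (k + 1) + 1) i))
      (Set.Iic (2 * k + 2)) := by
    intro a ha b hb hab
    have h := congrArg Fin.val (hc hab)
    simp only [Set.mem_Iic] at ha hb
    simpa [Fin.ofNat, Nat.mod_eq_of_lt (show a < 2 * (k + 1) + 1 by omega),
      Nat.mod_eq_of_lt (show b < 2 * (k + 1) + 1 by omega)] using h
  have h := even_path_sum_add_chord_ge v hsymm htri1 htri2 _ k hinj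
  have hlast : Fin.ofNat (2 * (k + 1) + 1) (2 * k + 2 + 1) = Fin.ofNat (2 * (k + 1) + 1) 0 := by
    ext
    simp [Fin.ofNat, show 2 * k + 2 + 1 = 2 * (k + 1) + 1 by ring]
  have hsum : ∑ i : Fin (2 * (k + 1) + 1), v (c i) (c (i + 1)) =
      ∑ i ∈ Finset.range (2 * k + 2 + 1), v (c (Fin.ofNat (2 * (k + 1) + 1) i))
        (c (Fin.ofNat (2 * (k + 1) + 1) (i + 1))) := by
    rw [show 2 * k + 2 + 1 = 2 * (k + 1) + 1 by ring, Finset.sum_range]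
    refine Finset.sum_congr rfl fun i _ => ?_
    congr 2
    ext
    simp [Fin.ofNat, Nat.mod_eq_of_lt i.isLt]
  rw [hsum, Finset.sum_range_succ, hlast]
  push_cast
  linarith
end

section
/- Let G_L = (V, L) be a finite graph with edge weights w_e ≥ 0 and values x_e ∈ ℝ for e ∈ L satisfying: 5/9 < x_e ≤ 1 for every e ∈ L; x_e + x_f ≤ 4/3 for any two distinct edges e, f ∈ L sharing a vertex; every edge of L shares a vertex with some other edge of L; Σ_{e∈L} w_e(1 + 3x_e) > 0; and the vector (9/14)x is a convex combination of incidence vectors of matchings of G_L. Let y* be the incidence vector of a maximum-weight matching of G_L with respect to w. Then Σ_{e∈L} w_e(1 + 3y*_e) > (3/4)·Σ_{e∈L} w_e(1 + 3x_e). -/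
/-- `M` is a matching contained in the edge set `E`: `M ⊆ E` and no two distinct edges of
`M` share a vertex. -/
def IsMatchingIn {V : Type*} (M E : Finset (Sym2 V)) : Prop :=
  M ⊆ E ∧ ∀ e ∈ M, ∀ f ∈ M, e ≠ f → ∀ v : V, v ∈ e → v ∉ f

/-- Pairing a weight function with the indicator of a subset gives the weight of the subset. -/
theorem sum_mul_indicator {α : Type*} [DecidableEq α] {M E : Finset α} (h : M ⊆ E)
    (w : α → ℝ) :
    ∑ e ∈ E, w e * (if e ∈ M then (1 : ℝ) else 0) = ∑ e ∈ M, w e := by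
  simp only [mul_ite, mul_one, mul_zero]
  rw [Finset.sum_ite_mem, Finset.inter_eq_right.mpr h]

/-- The large-edge bound of Lemma 4.4: let `G_L = (V, L)` be a finite (loopless) graph
with edge weights `w_e ≥ 0` and values `x_e` satisfying `5/9 < x_e ≤ 1` on `L`,
`x_e + x_f ≤ 4/3` for distinct edges of `L` sharing a vertex, with no isolated edge in
`L`, total SDP weight `Σ_{e∈L} w_e(1+3x_e) > 0`, and such that `(9/14)x` is a convex
combination of incidence vectors of matchings of `G_L`.  If `F` is a maximum-weight
matching of `G_L` with respect to `w` (with incidence vector `y*`), then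
`Σ_{e∈L} w_e(1 + 3y*_e) > (3/4)·Σ_{e∈L} w_e(1 + 3x_e)`. -/
theorem large_edge_matching_bound {V : Type*} [Fintype V] [DecidableEq V]
    (L : Finset (Sym2 V)) (hL : ∀ e ∈ L, ¬e.IsDiag)
    (w x : Sym2 V → ℝ) (hw : ∀ e ∈ L, 0 ≤ w e)
    (hx : ∀ e ∈ L, 5 / 9 < x e ∧ x e ≤ 1)
    (hpair : ∀ e ∈ L, ∀ f ∈ L, e ≠ f → (∃ v : V, v ∈ e ∧ v ∈ f) →
      x e + x f ≤ 4 / 3)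
    (hnoiso : ∀ e ∈ L, ∃ f ∈ L, f ≠ e ∧ ∃ v : V, v ∈ e ∧ v ∈ f)
    (hpos : 0 < ∑ e ∈ L, w e * (1 + 3 * x e))
    {K : ℕ} (Ms : Fin K → Finset (Sym2 V)) (hMs : ∀ l, IsMatchingIn (Ms l) L)
    (μ : Fin K → ℝ) (hμ : ∀ l, 0 ≤ μ l) (hμ1 : ∑ l, μ l = 1)
    (hconv : ∀ e ∈ L, (9 / 14 : ℝ) * x e = ∑ l, μ l * (if e ∈ Ms l then (1 : ℝ) else 0))
    (F : Finset (Sym2 V)) (hF : IsMatchingIn F L)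
    (hFmax : ∀ F' : Finset (Sym2 V), IsMatchingIn F' L →
      ∑ e ∈ F', w e ≤ ∑ e ∈ F, w e) :
    ∑ e ∈ L, w e * (1 + 3 * (if e ∈ F then (1 : ℝ) else 0)) >
      (3 / 4) * ∑ e ∈ L, w e * (1 + 3 * x e) := by
  have hFL : ∑ e ∈ L, w e * (if e ∈ F then (1 : ℝ) else 0) = ∑ e ∈ F, w e :=
    sum_mul_indicator hF.1 w
  have hmatch : (9 / 14 : ℝ) * ∑ e ∈ L, w e * x e ≤ ∑ e ∈ F, w e := by
    calc (9 / 14 : ℝ) * ∑ e ∈ L, w e * x e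
        = ∑ e ∈ L, ∑ l, μ l * (w e * (if e ∈ Ms l then (1 : ℝ) else 0)) := by
          rw [Finset.mul_sum]
          refine Finset.sum_congr rfl fun e he => ?_
          rw [mul_left_comm, hconv e he, Finset.mul_sum]
          exact Finset.sum_congr rfl fun l _ => mul_left_comm _ _ _
      _ = ∑ l, μ l * ∑ e ∈ Ms l, w e := by
          rw [Finset.sum_comm]
          refine Finset.sum_congr rfl fun l _ => ?_
          rw [← Finset.mul_sum, sum_mul_indicator (hMs l).1 w]
      _ ≤ ∑ l, μ l * ∑ e ∈ F, w e :=
          Finset.sum_le_sum fun l _ => mul_le_mul_of_nonneg_left (hFmax _ (hMs l)) (hμ l)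
      _ = ∑ e ∈ F, w e := by rw [← Finset.sum_mul, hμ1, one_mul]
  have hlt : ∀ e ∈ L, x e < 7 / 9 := by
    intro e he
    obtain ⟨f, hf, hne, hv⟩ := hnoiso e he
    linarith [hpair e he f hf hne.symm hv, (hx f hf).1]
  obtain ⟨e₀, he₀, hwe₀⟩ : ∃ e ∈ L, 0 < w e * (1 + 3 * x e) :=
    Finset.exists_lt_of_sum_lt (by simpa only [Finset.sum_const_zero] using hpos)
  have hw₀ : 0 < w e₀ := pos_of_mul_pos_left hwe₀ (by linarith [(hx e₀ he₀).1])
  have hslack : 0 < ∑ e ∈ L, w e * (7 / 9 - x e) :=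
    Finset.sum_pos' (fun e he => mul_nonneg (hw e he) (by linarith [hlt e he]))
      ⟨e₀, he₀, mul_pos hw₀ (by linarith [hlt e₀ he₀])⟩
  have hsplit : ∀ z : Sym2 V → ℝ,
      ∑ e ∈ L, w e * (1 + 3 * z e) = ∑ e ∈ L, w e + 3 * ∑ e ∈ L, w e * z e := by
    intro z
    rw [Finset.mul_sum, ← Finset.sum_add_distrib]
    exact Finset.sum_congr rfl fun e _ => by ring
  have hslack_eq : ∑ e ∈ L, w e * (7 / 9 - x e) =
      7 / 9 * ∑ e ∈ L, w e - ∑ e ∈ L, w e * x e := by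
    rw [Finset.mul_sum, ← Finset.sum_sub_distrib]
    exact Finset.sum_congr rfl fun e _ => by ring
  rw [hsplit, hsplit, hFL]
  linarith
end
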